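/- Let C₁ and C₂ be Cantor sets, Y = C₁ * C₂ their topological join, and ΣY the suspension of Y with suspension points n and p. Suppose Z is a subspace of ΣY and h : ΣZ → ΣY is a homeomorphism whose restriction to Z (identified with the image of Z × {1/2} in ΣZ) is the inclusion of Z into ΣY. Then for each c ∈ C₁ ∪ C₂ (viewed as a subset of Y ⊆ ΣY), the suspension arc of ΣY through c is the image under h of a suspension arc of ΣZ; in particular, the suspension arc of ΣY through c intersects Z in exactly one point. -/

import Mathlib

open Set Filter Topology

universe u

/-- The equivalence generating the unreduced suspension: collapse `W × {0}` to a point `n`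
and `W × {1}` to a point `p`. -/
def suspRel (W : Type u) : W × unitInterval → W × unitInterval → Prop := fun a b =>
  a = b ∨ (a.2 = 0 ∧ b.2 = 0) ∨ (a.2 = 1 ∧ b.2 = 1)

/-- The unreduced suspension `ΣW` of `W`, as a quotient of `W × [0,1]`. -/
def Susp (W : Type u) : Type u := Quot (suspRel W)

instance (W : Type u) [TopologicalSpace W] : TopologicalSpace (Susp W) :=
  inferInstanceAs (TopologicalSpace (Quot (suspRel W)))

/-- The image of `(w, t)` in the suspension. -/
def suspMk (W : Type u) [TopologicalSpace W] (w : W) (t : unitInterval) : Susp W :=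
  Quot.mk _ (w, t)

/-- The set `{n, p}` of the two suspension points of `ΣW` (for `W` nonempty),
i.e. the image of `W × {0, 1}`. -/
def suspPoles (W : Type u) [TopologicalSpace W] : Set (Susp W) :=
  {z | ∃ w t, z = suspMk W w t ∧ (t = 0 ∨ t = 1)}

/-- The suspension arc of `ΣW` through `w ∈ W`: the image of `{w} × [0,1]`. -/
def suspArc (W : Type u) [TopologicalSpace W] (w : W) : Set (Susp W) :=
  {z | ∃ t, z = suspMk W w t}

/-- The equivalence generating the topological join: identify `(a,b,0) ~ (a,b',0)` and
`(a,b,1) ~ (a',b,1)`. -/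
def joinRel (C₁ C₂ : Type u) : C₁ × C₂ × unitInterval → C₁ × C₂ × unitInterval → Prop :=
  fun x y =>
    x = y ∨ (x.2.2 = 0 ∧ y.2.2 = 0 ∧ x.1 = y.1) ∨ (x.2.2 = 1 ∧ y.2.2 = 1 ∧ x.2.1 = y.2.1)

/-- The topological join `C₁ * C₂`, as a quotient of `C₁ × C₂ × [0,1]`. -/
def TopJoin (C₁ C₂ : Type u) : Type u := Quot (joinRel C₁ C₂)

instance (C₁ C₂ : Type u) [TopologicalSpace C₁] [TopologicalSpace C₂] :
    TopologicalSpace (TopJoin C₁ C₂) :=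
  inferInstanceAs (TopologicalSpace (Quot (joinRel C₁ C₂)))

/-- The image of `(a, b, t)` in the join. -/
def joinMk (C₁ C₂ : Type u) [TopologicalSpace C₁] [TopologicalSpace C₂]
    (a : C₁) (b : C₂) (t : unitInterval) : TopJoin C₁ C₂ := Quot.mk _ (a, b, t)

/-- The copy of `C₁` inside `C₁ * C₂`: the image of `C₁ × C₂ × {0}`. -/
def joinC1 (C₁ C₂ : Type u) [TopologicalSpace C₁] [TopologicalSpace C₂] :
    Set (TopJoin C₁ C₂) := {y | ∃ a b, y = joinMk C₁ C₂ a b 0}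

/-- The copy of `C₂` inside `C₁ * C₂`: the image of `C₁ × C₂ × {1}`. -/
def joinC2 (C₁ C₂ : Type u) [TopologicalSpace C₁] [TopologicalSpace C₂] :
    Set (TopJoin C₁ C₂) := {y | ∃ a b, y = joinMk C₁ C₂ a b 1}

/-- The join arc from `a ∈ C₁` to `b ∈ C₂`: the image of `{(a,b)} × [0,1]`. -/
def joinArc (C₁ C₂ : Type u) [TopologicalSpace C₁] [TopologicalSpace C₂]
    (a : C₁) (b : C₂) : Set (TopJoin C₁ C₂) := {y | ∃ t, y = joinMk C₁ C₂ a b t}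

section ConnectednessProperties

variable {X X' : Type*} [TopologicalSpace X'] [TopologicalSpace X]

/-- `X` is connected im kleinen at `x`: points close to `x` are joined to `x` by small
preconnected sets. -/
def ConnectedImKleinenAt (x : X) : Prop :=
  ∀ U ∈ 𝓝 x, ∃ W ∈ 𝓝 x, ∀ w ∈ W, ∃ T ⊆ U, IsPreconnected T ∧ x ∈ T ∧ w ∈ T

/-- Some neighbourhood `U` of `x` has locally connected components, in the following sense:
points of `U` close to `y ∈ U` that are joined to `y` by a preconnected set in `U` are joined
to `y` by a small preconnected set. -/
def ComponentsLocallyConnectedAt (x : X) : Prop :=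
  ∃ U ∈ 𝓝 x, ∀ y ∈ U, ∀ V ∈ 𝓝 y, ∃ W ∈ 𝓝 y, ∀ T ⊆ U, IsPreconnected T → y ∈ T →
    ∀ w ∈ T, w ∈ W → ∃ T' ⊆ V, IsPreconnected T' ∧ y ∈ T' ∧ w ∈ T'

theorem Homeomorph.preimage_symm_mem_nhds (e : X ≃ₜ X') {x : X} {W : Set X} (hW : W ∈ 𝓝 x) :
    e.symm ⁻¹' W ∈ 𝓝 (e x) :=
  e.symm.continuous.continuousAt.preimage_mem_nhds (by simpa using hW)

theorem ConnectedImKleinenAt.map (e : X ≃ₜ X') {x : X} (hx : ConnectedImKleinenAt x) :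
    ConnectedImKleinenAt (e x) := by
  intro U hU
  obtain ⟨W, hW, h⟩ := hx _ (e.continuous.continuousAt.preimage_mem_nhds hU)
  refine ⟨e.symm ⁻¹' W, e.preimage_symm_mem_nhds hW, fun w hw => ?_⟩
  obtain ⟨T, hTU, hT, hxT, hwT⟩ := h _ hw
  exact ⟨e '' T, image_subset_iff.2 hTU, hT.image _ e.continuous.continuousOn,
    mem_image_of_mem e hxT, e.symm w, hwT, e.apply_symm_apply w⟩

theorem ComponentsLocallyConnectedAt.map (e : X ≃ₜ X') {x : X}
    (hx : ComponentsLocallyConnectedAt x) : ComponentsLocallyConnectedAt (e x) := by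
  obtain ⟨U, hU, h⟩ := hx
  refine ⟨e.symm ⁻¹' U, e.preimage_symm_mem_nhds hU, fun y hy V hV => ?_⟩
  obtain ⟨y, rfl⟩ := e.surjective y
  rw [mem_preimage, e.symm_apply_apply] at hy
  obtain ⟨W, hW, hWT⟩ := h y hy _ (e.continuous.continuousAt.preimage_mem_nhds hV)
  refine ⟨e.symm ⁻¹' W, e.preimage_symm_mem_nhds hW, fun T hTU hT hyT w hwT hwW => ?_⟩
  obtain ⟨T', hT'V, hT', hyT', hwT'⟩ := hWT (e.symm '' T) (image_subset_iff.2 hTU)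
    (hT.image _ e.symm.continuous.continuousOn) ⟨_, hyT, e.symm_apply_apply y⟩
    _ (mem_image_of_mem _ hwT) hwW
  exact ⟨e '' T', image_subset_iff.2 hT'V, hT'.image _ e.continuous.continuousOn,
    mem_image_of_mem e hyT', e.symm w, hwT', e.apply_symm_apply w⟩

end ConnectednessProperties

section PowerMap

/-- The homeomorphism `t ↦ t ^ α` of the unit interval. -/
noncomputable def unitIntervalPow (α : ℝ) (hα : 0 < α) : unitInterval ≃ₜ unitInterval where
  toFun t := ⟨(t : ℝ) ^ α, Real.rpow_nonneg t.2.1 _, Real.rpow_le_one t.2.1 t.2.2 hα.le⟩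
  invFun t := ⟨(t : ℝ) ^ α⁻¹, Real.rpow_nonneg t.2.1 _,
    Real.rpow_le_one t.2.1 t.2.2 (inv_pos.2 hα).le⟩
  left_inv t := Subtype.ext (Real.rpow_rpow_inv t.2.1 hα.ne')
  right_inv t := Subtype.ext (Real.rpow_inv_rpow t.2.1 hα.ne')
  continuous_toFun :=
    (continuous_subtype_val.rpow_const fun _ => Or.inr hα.le).subtype_mk _
  continuous_invFun :=
    (continuous_subtype_val.rpow_const fun _ => Or.inr (inv_pos.2 hα).le).subtype_mk _

theorem exists_unitInterval_homeomorph {r r' : unitInterval} (hr : 0 < r) (hr1 : r < 1)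
    (hr' : 0 < r') (hr1' : r' < 1) :
    ∃ φ : unitInterval ≃ₜ unitInterval, φ 0 = 0 ∧ φ 1 = 1 ∧ φ r = r' := by
  have hlog : Real.log r < 0 := Real.log_neg hr hr1
  have hlog' : Real.log r' < 0 := Real.log_neg hr' hr1'
  have hα : 0 < Real.log r' / Real.log r := div_pos_of_neg_of_neg hlog' hlog
  refine ⟨unitIntervalPow _ hα, Subtype.ext (Real.zero_rpow hα.ne'),
    Subtype.ext (Real.one_rpow _), Subtype.ext ?_⟩
  change (r : ℝ) ^ (Real.log r' / Real.log r) = r'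
  rw [Real.rpow_def_of_pos hr, mul_div_cancel₀ _ hlog.ne, Real.exp_log hr']

end PowerMap

section Suspension

variable {W W' : Type u} [TopologicalSpace W] [TopologicalSpace W']

theorem continuous_suspMk : Continuous fun p : W × unitInterval => suspMk W p.1 p.2 :=
  continuous_quot_mk

theorem exists_suspMk (x : Susp W) : ∃ w s, suspMk W w s = x := by
  obtain ⟨⟨w, s⟩, rfl⟩ := Quot.exists_rep x
  exact ⟨w, s, rfl⟩

theorem suspMk_zero_eq (w w' : W) : suspMk W w 0 = suspMk W w' 0 :=
  Quot.sound (Or.inr (Or.inl ⟨rfl, rfl⟩))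

theorem suspMk_one_eq (w w' : W) : suspMk W w 1 = suspMk W w' 1 :=
  Quot.sound (Or.inr (Or.inr ⟨rfl, rfl⟩))

/-- The second coordinate on the suspension. -/
def suspHeight : Susp W → unitInterval :=
  Quot.lift Prod.snd <| by
    rintro a b (rfl | ⟨h, h'⟩ | ⟨h, h'⟩)
    · rfl
    · rw [h, h']
    · rw [h, h']

@[simp]
theorem suspHeight_suspMk (w : W) (s : unitInterval) : suspHeight (suspMk W w s) = s := rfl

theorem continuous_suspHeight : Continuous (suspHeight : Susp W → unitInterval) :=
  continuous_quot_lift _ continuous_snd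

/-- The function `(w, s) ↦ f w * (s * (1 - s))` on the suspension. -/
noncomputable def suspScale (f : W → ℝ) : Susp W → ℝ :=
  Quot.lift (fun p => f p.1 * (p.2 * (1 - p.2))) <| by
    rintro a b (rfl | ⟨h, h'⟩ | ⟨h, h'⟩)
    · rfl
    · simp [h', h]
    · simp [h', h]

@[simp]
theorem suspScale_suspMk (f : W → ℝ) (w : W) (s : unitInterval) :
    suspScale f (suspMk W w s) = f w * (s * (1 - s)) := rfl

theorem continuous_suspScale {f : W → ℝ} (hf : Continuous f) : Continuous (suspScale f) :=
  continuous_quot_lift _ (by fun_prop)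

theorem height_mul_pos {s : unitInterval} (h0 : 0 < s) (h1 : s < 1) :
    0 < (s : ℝ) * (1 - s) :=
  mul_pos h0 (sub_pos.2 h1)

theorem suspScale_ne_zero {f : W → ℝ} {w : W} {s : unitInterval}
    (h : suspScale f (suspMk W w s) ≠ 0) : f w ≠ 0 ∧ 0 < s ∧ s < 1 := by
  rw [suspScale_suspMk] at h
  refine ⟨left_ne_zero_of_mul h, ?_, ?_⟩
  · refine lt_of_le_of_ne unitInterval.nonneg' ?_
    rintro rfl
    simp at h
  · refine lt_of_le_of_ne unitInterval.le_one' ?_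
    rintro rfl
    simp at h

/-- A continuous function on `W` without zeros on the shadow of a preconnected set that avoids
the suspension points does not change sign on that shadow. -/
theorem IsPreconnected.pos_of_suspMk_mem {T : Set (Susp W)} (hT : IsPreconnected T)
    {f : W → ℝ} (hf : Continuous f)
    (h0 : ∀ w s, suspMk W w s ∈ T → 0 < s ∧ s < 1 ∧ f w ≠ 0)
    {w w' : W} {s s' : unitInterval} (hw : suspMk W w s ∈ T) (hw' : suspMk W w' s' ∈ T)
    (hpos : 0 < f w) : 0 < f w' := by
  obtain ⟨hs0, hs1, -⟩ := h0 _ _ hw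
  obtain ⟨hs0', hs1', -⟩ := h0 _ _ hw'
  by_contra hneg
  have hord := (hT.image _ (continuous_suspScale hf).continuousOn).ordConnected
  have hmem : (0 : ℝ) ∈ suspScale f '' T := by
    refine hord.out (mem_image_of_mem _ hw') (mem_image_of_mem _ hw) ⟨?_, ?_⟩
    · exact mul_nonpos_of_nonpos_of_nonneg (not_lt.1 hneg) (height_mul_pos hs0' hs1').le
    · exact mul_nonneg hpos.le (height_mul_pos hs0 hs1).le
  obtain ⟨x, hx, hx0⟩ := hmem
  obtain ⟨v, t, rfl⟩ := exists_suspMk x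
  obtain ⟨ht0, ht1, hv⟩ := h0 _ _ hx
  exact mul_ne_zero hv (height_mul_pos ht0 ht1).ne' hx0

/-- The map of suspensions induced by a map of the base and a map of the interval that preserves
or swaps the end points. -/
def suspMap (k : W → W') (ψ : unitInterval → unitInterval)
    (hψ : (ψ 0 = 0 ∧ ψ 1 = 1) ∨ (ψ 0 = 1 ∧ ψ 1 = 0)) : Susp W → Susp W' :=
  Quot.lift (fun p => suspMk W' (k p.1) (ψ p.2)) <| by
    rintro ⟨w, s⟩ ⟨w', s'⟩ (h | ⟨rfl, rfl⟩ | ⟨rfl, rfl⟩)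
    · rw [h]
    all_goals
      dsimp only
      rcases hψ with ⟨h0, h1⟩ | ⟨h0, h1⟩
      · simp only [h0, h1, suspMk_zero_eq (k w) (k w'), suspMk_one_eq (k w) (k w')]
      · simp only [h0, h1, suspMk_zero_eq (k w) (k w'), suspMk_one_eq (k w) (k w')]

theorem continuous_suspMap {k : W → W'} (hk : Continuous k) {ψ : unitInterval → unitInterval}
    (hc : Continuous ψ) (hψ : (ψ 0 = 0 ∧ ψ 1 = 1) ∨ (ψ 0 = 1 ∧ ψ 1 = 0)) :
    Continuous (suspMap k ψ hψ) :=
  continuous_quot_lift _ (continuous_suspMk.comp (f := fun p : W × unitInterval =>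
    (k p.1, ψ p.2)) (by fun_prop))

/-- The homeomorphism of suspensions induced by a homeomorphism of the bases and a homeomorphism
of the interval. -/
def suspCongr (e : W ≃ₜ W') (φ : unitInterval ≃ₜ unitInterval)
    (hφ : (φ 0 = 0 ∧ φ 1 = 1) ∨ (φ 0 = 1 ∧ φ 1 = 0)) : Susp W ≃ₜ Susp W' where
  toFun := suspMap e φ hφ
  invFun := suspMap e.symm φ.symm <| by
    rcases hφ with ⟨h0, h1⟩ | ⟨h0, h1⟩
    · exact Or.inl ⟨φ.symm_apply_eq.2 h0.symm, φ.symm_apply_eq.2 h1.symm⟩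
    · exact Or.inr ⟨φ.symm_apply_eq.2 h1.symm, φ.symm_apply_eq.2 h0.symm⟩
  left_inv x := by
    obtain ⟨w, s, rfl⟩ := exists_suspMk x
    change suspMk W (e.symm (e w)) (φ.symm (φ s)) = _
    simp
  right_inv x := by
    obtain ⟨w, s, rfl⟩ := exists_suspMk x
    change suspMk W' (e (e.symm w)) (φ (φ.symm s)) = _
    simp
  continuous_toFun := continuous_suspMap e.continuous φ.continuous _
  continuous_invFun := continuous_suspMap e.symm.continuous φ.symm.continuous _

theorem suspCongr_suspMk (e : W ≃ₜ W') (φ : unitInterval ≃ₜ unitInterval)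
    (hφ : (φ 0 = 0 ∧ φ 1 = 1) ∨ (φ 0 = 1 ∧ φ 1 = 0)) (w : W) (s : unitInterval) :
    suspCongr e φ hφ (suspMk W w s) = suspMk W' (e w) (φ s) := rfl

theorem isPreconnected_image_suspMk (w : W) {A : Set unitInterval} (hA : IsPreconnected A) :
    IsPreconnected (suspMk W w '' A) :=
  hA.image _ (continuous_suspMk.comp (Continuous.prodMk_right w)).continuousOn

theorem connectedImKleinenAt_suspMk_zero (w : W) : ConnectedImKleinenAt (suspMk W w 0) := by
  intro U hU
  obtain ⟨O, hOU, hO, hwO⟩ := mem_nhds_iff.1 hU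
  let S : Set (W × unitInterval) := {p | p.2 < 1 ∧ ∀ t ≤ p.2, suspMk W p.1 t ∈ O}
  have hS : IsOpen S := by
    have hK : IsClosed {q : (W × unitInterval) × unitInterval |
        q.2 ≤ q.1.2 ∧ suspMk W q.1.1 q.2 ∈ Oᶜ} := by
      refine (isClosed_le (by fun_prop) (by fun_prop)).inter
        (hO.isClosed_compl.preimage (continuous_suspMk.comp
          (f := fun q : (W × unitInterval) × unitInterval => (q.1.1, q.2)) (by fun_prop)))
    have hF := (isClosedMap_fst_of_compactSpace _ hK).isOpen_compl
    convert (isOpen_lt (f := fun p : W × unitInterval => p.2) (g := fun _ => 1)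
      (by fun_prop) (by fun_prop)).inter hF using 1
    ext p
    simp [S]
  have hzero (v : W) : (v, (0 : unitInterval)) ∈ S := by
    refine ⟨zero_lt_one, fun t ht => ?_⟩
    rw [le_antisymm ht unitInterval.nonneg']
    simpa only [suspMk_zero_eq v w] using hwO
  let N : Set (Susp W) := {x | Quot.lift (· ∈ S) (by
    rintro ⟨v, s⟩ ⟨v', s'⟩ (h | ⟨rfl, rfl⟩ | ⟨rfl, rfl⟩)
    · rw [h]
    · exact propext ⟨fun _ => hzero v', fun _ => hzero v⟩
    · exact propext ⟨fun h => absurd h.1 (lt_irrefl _), fun h => absurd h.1 (lt_irrefl _)⟩) x}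
  have hN : IsOpen N := isOpen_coinduced.2 hS
  refine ⟨N, hN.mem_nhds (hzero w), fun x hx => ?_⟩
  obtain ⟨v, s, rfl⟩ := exists_suspMk x
  obtain ⟨-, hs⟩ : (v, s) ∈ S := hx
  refine ⟨suspMk W v '' Iic s, ?_, isPreconnected_image_suspMk v isPreconnected_Iic,
    ⟨0, unitInterval.nonneg', suspMk_zero_eq v w⟩, s, self_mem_Iic, rfl⟩
  rintro _ ⟨t, ht, rfl⟩
  exact hOU (hs t ht)

theorem connectedImKleinenAt_suspMk_one (w : W) : ConnectedImKleinenAt (suspMk W w 1) := by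
  have h := (connectedImKleinenAt_suspMk_zero w).map (suspCongr (Homeomorph.refl W)
    unitInterval.symmHomeomorph (Or.inr ⟨unitInterval.symm_zero, unitInterval.symm_one⟩))
  rwa [suspCongr_suspMk, show unitInterval.symmHomeomorph 0 = 1 from unitInterval.symm_zero] at h

end Suspension

section Join

variable {C₁ C₂ : Type u} [TopologicalSpace C₁] [TopologicalSpace C₂]

theorem continuous_joinMk :
    Continuous fun p : C₁ × C₂ × unitInterval => joinMk C₁ C₂ p.1 p.2.1 p.2.2 :=
  continuous_quot_mk

theorem exists_joinMk (y : TopJoin C₁ C₂) : ∃ a b t, joinMk C₁ C₂ a b t = y := by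
  obtain ⟨⟨a, b, t⟩, rfl⟩ := Quot.exists_rep y
  exact ⟨a, b, t, rfl⟩

theorem joinMk_zero_eq (a : C₁) (b b' : C₂) : joinMk C₁ C₂ a b 0 = joinMk C₁ C₂ a b' 0 :=
  Quot.sound (Or.inr (Or.inl ⟨rfl, rfl, rfl⟩))

theorem joinMk_one_eq (a a' : C₁) (b : C₂) : joinMk C₁ C₂ a b 1 = joinMk C₁ C₂ a' b 1 :=
  Quot.sound (Or.inr (Or.inr ⟨rfl, rfl, rfl⟩))

/-- The join parameter, which vanishes on `C₁` and equals `1` on `C₂`. -/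
noncomputable def joinParam : TopJoin C₁ C₂ → ℝ :=
  Quot.lift (fun p => p.2.2) <| by
    rintro a b (rfl | ⟨h, hb, -⟩ | ⟨h, hb, -⟩)
    · rfl
    · simp [hb, h]
    · simp [hb, h]

/-- The function `(a, b, t) ↦ f a * (1 - t)` on the join. -/
noncomputable def joinLeft (f : C₁ → ℝ) : TopJoin C₁ C₂ → ℝ :=
  Quot.lift (fun p => f p.1 * (1 - p.2.2)) <| by
    rintro a b (rfl | ⟨h, hb, h₁⟩ | ⟨h, hb, -⟩)
    · rfl
    · simp [h, hb, h₁]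
    · simp [hb, h]

/-- The function `(a, b, t) ↦ g b * t` on the join. -/
noncomputable def joinRight (g : C₂ → ℝ) : TopJoin C₁ C₂ → ℝ :=
  Quot.lift (fun p => g p.2.1 * p.2.2) <| by
    rintro a b (rfl | ⟨h, hb, -⟩ | ⟨h, hb, h₂⟩)
    · rfl
    · simp [hb, h]
    · simp [h, hb, h₂]

@[simp]
theorem joinParam_joinMk (a : C₁) (b : C₂) (t : unitInterval) :
    joinParam (joinMk C₁ C₂ a b t) = t := rfl

@[simp]
theorem joinLeft_joinMk (f : C₁ → ℝ) (a : C₁) (b : C₂) (t : unitInterval) :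
    joinLeft f (joinMk C₁ C₂ a b t) = f a * (1 - t) := rfl

@[simp]
theorem joinRight_joinMk (g : C₂ → ℝ) (a : C₁) (b : C₂) (t : unitInterval) :
    joinRight g (joinMk C₁ C₂ a b t) = g b * t := rfl

theorem continuous_joinParam : Continuous (joinParam : TopJoin C₁ C₂ → ℝ) :=
  continuous_quot_lift _ (by fun_prop)

theorem continuous_joinLeft {f : C₁ → ℝ} (hf : Continuous f) :
    Continuous (joinLeft f : TopJoin C₁ C₂ → ℝ) :=
  continuous_quot_lift _ (by fun_prop)

theorem continuous_joinRight {g : C₂ → ℝ} (hg : Continuous g) :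
    Continuous (joinRight g : TopJoin C₁ C₂ → ℝ) :=
  continuous_quot_lift _ (by fun_prop)

/-- The map `C₁ * C₂ → C₂ * C₁` reversing the join parameter. -/
def joinSwap : TopJoin C₁ C₂ → TopJoin C₂ C₁ :=
  Quot.lift (fun p => joinMk C₂ C₁ p.2.1 p.1 (unitInterval.symm p.2.2)) <| by
    rintro ⟨a, b, t⟩ ⟨a', b', t'⟩ (h | ⟨rfl, rfl, rfl⟩ | ⟨rfl, rfl, rfl⟩)
    · rw [h]
    · simpa using joinMk_one_eq b b' a
    · simpa using joinMk_zero_eq b a a'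

theorem joinSwap_joinMk (a : C₁) (b : C₂) (t : unitInterval) :
    joinSwap (joinMk C₁ C₂ a b t) = joinMk C₂ C₁ b a (unitInterval.symm t) := rfl

theorem joinSwap_joinSwap (y : TopJoin C₁ C₂) : joinSwap (joinSwap y) = y := by
  obtain ⟨a, b, t, rfl⟩ := exists_joinMk y
  simp [joinSwap_joinMk]

theorem continuous_joinSwap : Continuous (joinSwap : TopJoin C₁ C₂ → TopJoin C₂ C₁) :=
  continuous_quot_lift _ (continuous_joinMk.comp (f := fun p : C₁ × C₂ × unitInterval =>
    (p.2.1, p.1, unitInterval.symm p.2.2)) (by fun_prop))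

variable (C₁ C₂) in
/-- The homeomorphism `C₁ * C₂ ≃ C₂ * C₁` reversing the join parameter. -/
def joinComm : TopJoin C₁ C₂ ≃ₜ TopJoin C₂ C₁ where
  toFun := joinSwap
  invFun := joinSwap
  left_inv := joinSwap_joinSwap
  right_inv := joinSwap_joinSwap
  continuous_toFun := continuous_joinSwap
  continuous_invFun := continuous_joinSwap

end Join

section SuspendedJoin

variable {C₁ C₂ : Type u} [TopologicalSpace C₁] [TopologicalSpace C₂]

/-- The point of `Σ(C₁ * C₂)` with coordinates `(a, b, t, s)`. -/
def suspJoinMk (p : C₁ × C₂ × unitInterval × unitInterval) : Susp (TopJoin C₁ C₂) :=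
  suspMk _ (joinMk C₁ C₂ p.1 p.2.1 p.2.2.1) p.2.2.2

theorem continuous_suspJoinMk :
    Continuous (suspJoinMk : C₁ × C₂ × unitInterval × unitInterval → _) :=
  continuous_suspMk.comp <| (continuous_joinMk.comp
    (f := fun p : C₁ × C₂ × unitInterval × unitInterval => (p.1, p.2.1, p.2.2.1))
    (by fun_prop)).prodMk (by fun_prop)

theorem exists_suspJoinMk (x : Susp (TopJoin C₁ C₂)) : ∃ a b t s, suspJoinMk (a, b, t, s) = x := by
  obtain ⟨y, s, rfl⟩ := exists_suspMk x
  obtain ⟨a, b, t, rfl⟩ := exists_joinMk y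
  exact ⟨a, b, t, s, rfl⟩

variable (C₁ C₂) in
/-- The points of `Σ(C₁ * C₂)` not in the suspension of `C₂`. -/
def leftPart : Set (Susp (TopJoin C₁ C₂)) := {x | suspScale (joinLeft fun _ => 1) x ≠ 0}

variable (C₁ C₂) in
/-- The points of `Σ(C₁ * C₂)` not in the suspension of `C₁`. -/
def rightPart : Set (Susp (TopJoin C₁ C₂)) := {x | suspScale (joinRight fun _ => 1) x ≠ 0}

theorem isOpen_leftPart : IsOpen (leftPart C₁ C₂) :=
  isOpen_ne_fun (continuous_suspScale (continuous_joinLeft continuous_const)) continuous_const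

theorem isOpen_rightPart : IsOpen (rightPart C₁ C₂) :=
  isOpen_ne_fun (continuous_suspScale (continuous_joinRight continuous_const)) continuous_const

theorem suspJoinMk_mem_leftPart {a : C₁} {b : C₂} {t s : unitInterval} :
    suspJoinMk (a, b, t, s) ∈ leftPart C₁ C₂ ↔ t < 1 ∧ 0 < s ∧ s < 1 := by
  constructor
  · intro h
    obtain ⟨ht, hs⟩ := suspScale_ne_zero h
    refine ⟨lt_of_le_of_ne unitInterval.le_one' ?_, hs⟩
    rintro rfl
    simp at ht
  · rintro ⟨ht, hs0, hs1⟩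
    refine mul_ne_zero (mul_ne_zero one_ne_zero (sub_pos.2 ?_).ne') (height_mul_pos hs0 hs1).ne'
    exact ht

theorem suspJoinMk_mem_rightPart {a : C₁} {b : C₂} {t s : unitInterval} :
    suspJoinMk (a, b, t, s) ∈ rightPart C₁ C₂ ↔ 0 < t ∧ 0 < s ∧ s < 1 := by
  constructor
  · intro h
    obtain ⟨ht, hs⟩ := suspScale_ne_zero h
    refine ⟨lt_of_le_of_ne unitInterval.nonneg' ?_, hs⟩
    rintro rfl
    simp at ht
  · rintro ⟨ht, hs0, hs1⟩
    refine mul_ne_zero (mul_ne_zero one_ne_zero (ne_of_gt ?_)) (height_mul_pos hs0 hs1).ne'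
    exact ht

theorem exists_continuous_pos_neg {C : Type*} [TopologicalSpace C] [TotallySeparatedSpace C]
    {a a' : C} (h : a ≠ a') :
    ∃ f : C → ℝ, Continuous f ∧ (∀ c, f c ≠ 0) ∧ 0 < f a ∧ f a' < 0 := by
  classical
  obtain ⟨K, hK, haK, hcK⟩ := exists_isClopen_of_totally_separated h
  refine ⟨fun c => if c ∈ K then 1 else -1, ?_, fun c => ?_, ?_, ?_⟩
  · refine continuous_const.if (fun c hc => ?_) continuous_const
    rw [show {c | c ∈ K} = K from rfl, hK.frontier_eq] at hc
    exact hc.elim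
  · dsimp only
    split_ifs <;> norm_num
  · simp [haK]
  · simp [show a' ∉ K from hcK]

/-- Preconnected sets off the suspension of `C₂` have constant first coordinate. -/
theorem IsPreconnected.fst_eq [TotallySeparatedSpace C₁] {T : Set (Susp (TopJoin C₁ C₂))}
    (hT : IsPreconnected T) (hTU : T ⊆ leftPart C₁ C₂) {a a' : C₁} {b b' : C₂}
    {t t' s s' : unitInterval} (h : suspJoinMk (a, b, t, s) ∈ T)
    (h' : suspJoinMk (a', b', t', s') ∈ T) : a = a' := by
  by_contra hne
  obtain ⟨f, hf, hf0, hfa, hfa'⟩ := exists_continuous_pos_neg hne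
  have hpos := hT.pos_of_suspMk_mem (continuous_joinLeft hf) (fun y r hy => by
    obtain ⟨c, d, t, rfl⟩ := exists_joinMk y
    obtain ⟨ht, hr⟩ := suspJoinMk_mem_leftPart.1 (hTU hy)
    exact ⟨hr.1, hr.2, mul_ne_zero (hf0 c) (sub_pos.2 (show (t : ℝ) < 1 from ht)).ne'⟩) h h'
    (mul_pos hfa (sub_pos.2 (suspJoinMk_mem_leftPart.1 (hTU h)).1))
  exact hpos.not_ge (mul_nonpos_of_nonpos_of_nonneg hfa'.le (unitInterval.one_minus_nonneg _))

/-- Preconnected sets off the suspension of `C₁` have constant second coordinate. -/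
theorem IsPreconnected.snd_eq [TotallySeparatedSpace C₂] {T : Set (Susp (TopJoin C₁ C₂))}
    (hT : IsPreconnected T) (hTU : T ⊆ rightPart C₁ C₂) {a a' : C₁} {b b' : C₂}
    {t t' s s' : unitInterval} (h : suspJoinMk (a, b, t, s) ∈ T)
    (h' : suspJoinMk (a', b', t', s') ∈ T) : b = b' := by
  by_contra hne
  obtain ⟨f, hf, hf0, hfb, hfb'⟩ := exists_continuous_pos_neg hne
  have hpos := hT.pos_of_suspMk_mem (continuous_joinRight hf) (fun y r hy => by
    obtain ⟨c, d, t, rfl⟩ := exists_joinMk y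
    obtain ⟨ht, hr⟩ := suspJoinMk_mem_rightPart.1 (hTU hy)
    exact ⟨hr.1, hr.2, mul_ne_zero (hf0 d) (ne_of_gt (show (0 : ℝ) < t from ht))⟩) h h'
    (mul_pos hfb (suspJoinMk_mem_rightPart.1 (hTU h)).1)
  exact hpos.not_ge (mul_nonpos_of_nonpos_of_nonneg hfb'.le (unitInterval.nonneg _))

/-- Near a point of a perfect space there are other points. -/
theorem exists_ne_of_eventually {C : Type*} [TopologicalSpace C] [PerfectSpace C] {a : C}
    {p : C → Prop} (h : ∀ᶠ c in 𝓝 a, p c) : ∃ c ≠ a, p c :=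
  ((h.filter_mono nhdsWithin_le_nhds).and (eventually_mem_nhdsWithin (s := {a}ᶜ))).exists.imp
    fun _ hc => ⟨hc.2, hc.1⟩

theorem not_connectedImKleinenAt_suspJoinMk [TotallySeparatedSpace C₁] [PerfectSpace C₁]
    [TotallySeparatedSpace C₂] [PerfectSpace C₂] {a : C₁} {b : C₂} {t s : unitInterval}
    (hs0 : 0 < s) (hs1 : s < 1) : ¬ ConnectedImKleinenAt (suspJoinMk (a, b, t, s)) := by
  intro hx
  rcases lt_or_eq_of_le (unitInterval.le_one' (t := t)) with ht | rfl
  · have hU := isOpen_leftPart.mem_nhds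
      (suspJoinMk_mem_leftPart (a := a) (b := b).2 ⟨ht, hs0, hs1⟩)
    obtain ⟨W, hW, h⟩ := hx _ hU
    have hcont : Continuous fun c : C₁ => suspJoinMk (c, b, t, s) :=
      continuous_suspJoinMk.comp (by fun_prop)
    obtain ⟨c, hca, hc⟩ := exists_ne_of_eventually (hcont.continuousAt (x := a) hW)
    obtain ⟨T, hTU, hT, haT, hcT⟩ := h _ hc
    exact hca (hT.fst_eq hTU hcT haT)
  · have hU := isOpen_rightPart.mem_nhds
      (suspJoinMk_mem_rightPart (a := a) (b := b).2 ⟨zero_lt_one, hs0, hs1⟩)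
    obtain ⟨W, hW, h⟩ := hx _ hU
    have hcont : Continuous fun c : C₂ => suspJoinMk (a, c, 1, s) :=
      continuous_suspJoinMk.comp (by fun_prop)
    obtain ⟨c, hcb, hc⟩ := exists_ne_of_eventually (hcont.continuousAt (x := b) hW)
    obtain ⟨T, hTU, hT, hbT, hcT⟩ := h _ hc
    exact hcb (hT.snd_eq hTU hcT hbT)

theorem componentsLocallyConnectedAt_suspJoinMk [TotallySeparatedSpace C₁]
    [TotallySeparatedSpace C₂] {a : C₁} {b : C₂} {t s : unitInterval}
    (ht0 : 0 < t) (ht1 : t < 1) (hs0 : 0 < s) (hs1 : s < 1) :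
    ComponentsLocallyConnectedAt (suspJoinMk (a, b, t, s)) := by
  refine ⟨leftPart C₁ C₂ ∩ rightPart C₁ C₂,
    (isOpen_leftPart.inter isOpen_rightPart).mem_nhds
      ⟨suspJoinMk_mem_leftPart.2 ⟨ht1, hs0, hs1⟩, suspJoinMk_mem_rightPart.2 ⟨ht0, hs0, hs1⟩⟩, ?_⟩
  intro y hy V hV
  obtain ⟨a, b, t, s, rfl⟩ := exists_suspJoinMk y
  obtain ⟨-, hs0, hs1⟩ := suspJoinMk_mem_rightPart.1 hy.2
  have hcont : Continuous fun p : unitInterval × unitInterval => suspJoinMk (a, b, p) :=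
    continuous_suspJoinMk.comp (by fun_prop)
  obtain ⟨r, hr, hball⟩ := Metric.mem_nhds_iff.1 (hcont.continuousAt (x := (t, s)) hV)
  let τ : Susp (TopJoin C₁ C₂) → ℝ × ℝ := fun x =>
    (suspScale joinParam x / (suspHeight x * (1 - suspHeight x)), suspHeight x)
  have hτ (a' : C₁) (b' : C₂) (t' s' : unitInterval) (h0 : 0 < s') (h1 : s' < 1) :
      τ (suspJoinMk (a', b', t', s')) = (↑t', ↑s') :=
    Prod.ext (mul_div_cancel_right₀ _ (height_mul_pos h0 h1).ne') rfl
  have hheight := continuous_suspHeight (W := TopJoin C₁ C₂)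
  have hτc : ContinuousAt τ (suspJoinMk (a, b, t, s)) := by
    refine ContinuousAt.prodMk (ContinuousAt.div
      (continuous_suspScale continuous_joinParam).continuousAt (by fun_prop) ?_) (by fun_prop)
    exact (height_mul_pos hs0 hs1).ne'
  refine ⟨τ ⁻¹' Metric.ball (τ (suspJoinMk (a, b, t, s))) r,
    hτc.preimage_mem_nhds (Metric.ball_mem_nhds _ hr), fun T hTU hT hyT w hwT hwW => ?_⟩
  obtain ⟨a', b', t', s', rfl⟩ := exists_suspJoinMk w
  obtain rfl := hT.fst_eq (hTU.trans inter_subset_left) hyT hwT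
  obtain rfl := hT.snd_eq (hTU.trans inter_subset_right) hyT hwT
  obtain ⟨-, hs0', hs1'⟩ := suspJoinMk_mem_rightPart.1 (hTU hwT).2
  rw [mem_preimage, hτ _ _ _ _ hs0 hs1, hτ _ _ _ _ hs0' hs1'] at hwW
  refine ⟨(fun p => suspJoinMk (a, b, p)) '' Metric.ball (t, s) r, image_subset_iff.2 hball, ?_,
    mem_image_of_mem _ (Metric.mem_ball_self hr), mem_image_of_mem _ hwW⟩
  refine IsPreconnected.image ?_ _ hcont.continuousOn
  rw [← ball_prod_same]
  refine IsPreconnected.prod ?_ ?_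
  all_goals
    refine OrdConnected.isPreconnected ?_
    rw [← Subtype.preimage_ball, Real.ball_eq_Ioo]
    exact ordConnected_Ioo.preimage_mono (Subtype.mono_coe _)

theorem not_componentsLocallyConnectedAt_suspJoinMk_zero [TotallySeparatedSpace C₂]
    [PerfectSpace C₂] {a : C₁} {b : C₂} {s : unitInterval} (hs0 : 0 < s) (hs1 : s < 1) :
    ¬ ComponentsLocallyConnectedAt (suspJoinMk (a, b, 0, s)) := by
  rintro ⟨U, hU, h⟩
  have hcont : Continuous fun p : C₂ × unitInterval => suspJoinMk (a, p.1, p.2, s) :=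
    continuous_suspJoinMk.comp (by fun_prop)
  obtain ⟨B, hB, D, hD, hBD⟩ :=
    mem_nhds_prod_iff.1 (hcont.continuousAt (x := (b, 0)) hU)
  obtain ⟨ε, hε0, hε1, hεD⟩ : ∃ ε : unitInterval, 0 < ε ∧ ε < 1 ∧ Iic ε ⊆ D := by
    obtain ⟨δ, hδ, hδD⟩ := (nhds_bot_basis_Iic (α := unitInterval)).mem_iff.1 hD
    obtain ⟨ε, hε0, hεδ⟩ := exists_between hδ
    exact ⟨ε, hε0, hεδ.trans_le unitInterval.le_one', (Iic_subset_Iic.2 hεδ.le).trans hδD⟩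
  have hIic (c : C₂) (hc : c ∈ B) : (fun p => suspJoinMk (a, c, p, s)) '' Iic ε ⊆ U := by
    rintro _ ⟨p, hp, rfl⟩
    exact hBD (mk_mem_prod hc (hεD hp))
  have hpre (c : C₂) : IsPreconnected ((fun p => suspJoinMk (a, c, p, s)) '' Iic ε) :=
    isPreconnected_Iic.image _ (hcont.comp (Continuous.prodMk_right c)).continuousOn
  have hbB : b ∈ B := mem_of_mem_nhds hB
  have hy : suspJoinMk (a, b, ε, s) ∈ rightPart C₁ C₂ :=
    suspJoinMk_mem_rightPart.2 ⟨hε0, hs0, hs1⟩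
  obtain ⟨W, hW, hWT⟩ := h _ (hIic b hbB ⟨ε, self_mem_Iic, rfl⟩) _ (isOpen_rightPart.mem_nhds hy)
  have hcontb : Continuous fun c : C₂ => suspJoinMk (a, c, ε, s) :=
    hcont.comp (Continuous.prodMk_left ε)
  obtain ⟨c, hcb, hcW, hcB⟩ := exists_ne_of_eventually
    ((hcontb.continuousAt (x := b).eventually_mem hW).and hB)
  obtain ⟨T', hT'V, hT', hyT', hwT'⟩ := hWT _ (union_subset (hIic b hbB) (hIic c hcB))
    ((hpre b).union (suspJoinMk (a, b, 0, s)) ⟨0, unitInterval.nonneg', rfl⟩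
      ⟨0, unitInterval.nonneg', congrArg (suspMk _ · s) (joinMk_zero_eq a c b)⟩ (hpre c))
    (Or.inl ⟨ε, self_mem_Iic, rfl⟩) _ (Or.inr ⟨ε, self_mem_Iic, rfl⟩) hcW
  exact hcb (hT'.snd_eq hT'V hwT' hyT')

end SuspendedJoin

section Homeomorphisms

theorem suspMk_eq_of_pole {W : Type u} [TopologicalSpace W] {x y : Susp W}
    (hxy : suspHeight x = suspHeight y) (hx : suspHeight x = 0 ∨ suspHeight x = 1) : x = y := by
  obtain ⟨w, s, rfl⟩ := exists_suspMk x
  obtain ⟨w', s', rfl⟩ := exists_suspMk y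
  obtain rfl : s = s' := hxy
  obtain rfl | rfl : s = 0 ∨ s = 1 := hx
  · exact suspMk_zero_eq w w'
  · exact suspMk_one_eq w w'

theorem interior_iff_not_pole {s : unitInterval} : 0 < s ∧ s < 1 ↔ ¬ (s = 0 ∨ s = 1) := by
  rw [not_or, lt_iff_le_and_ne, lt_iff_le_and_ne]
  simp [unitInterval.le_one', eq_comm]

variable {C₁ C₂ V : Type u} [TopologicalSpace C₁] [TopologicalSpace C₂] [TopologicalSpace V]
  [TotallySeparatedSpace C₁] [PerfectSpace C₁] [TotallySeparatedSpace C₂] [PerfectSpace C₂]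

theorem suspHeight_eq_of_connectedImKleinenAt {x : Susp (TopJoin C₁ C₂)}
    (hx : ConnectedImKleinenAt x) : suspHeight x = 0 ∨ suspHeight x = 1 := by
  obtain ⟨a, b, t, s, rfl⟩ := exists_suspJoinMk x
  by_contra hs
  obtain ⟨hs0, hs1⟩ := interior_iff_not_pole.2 hs
  exact not_connectedImKleinenAt_suspJoinMk hs0 hs1 hx

/-- A homeomorphism onto `Σ(C₁ * C₂)` from a suspension preserves suspension points. -/
theorem suspHeight_homeomorph_pole (h : Susp V ≃ₜ Susp (TopJoin C₁ C₂)) {x : Susp V}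
    (hx : suspHeight x = 0 ∨ suspHeight x = 1) :
    suspHeight (h x) = 0 ∨ suspHeight (h x) = 1 := by
  obtain ⟨w, s, rfl⟩ := exists_suspMk x
  obtain rfl | rfl : s = 0 ∨ s = 1 := hx
  · exact suspHeight_eq_of_connectedImKleinenAt ((connectedImKleinenAt_suspMk_zero w).map h)
  · exact suspHeight_eq_of_connectedImKleinenAt ((connectedImKleinenAt_suspMk_one w).map h)

theorem suspHeight_homeomorph_pole_iff (h : Susp V ≃ₜ Susp (TopJoin C₁ C₂)) {x : Susp V} :
    (suspHeight (h x) = 0 ∨ suspHeight (h x) = 1) ↔ (suspHeight x = 0 ∨ suspHeight x = 1) := by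
  refine ⟨fun hx => ?_, suspHeight_homeomorph_pole h⟩
  obtain ⟨w, s, rfl⟩ := exists_suspMk x
  have h0 := suspHeight_homeomorph_pole h (x := suspMk V w 0) (Or.inl rfl)
  have h1 := suspHeight_homeomorph_pole h (x := suspMk V w 1) (Or.inr rfl)
  have hne : suspHeight (h (suspMk V w 0)) ≠ suspHeight (h (suspMk V w 1)) := fun heq =>
    zero_ne_one (congrArg suspHeight (h.injective (suspMk_eq_of_pole heq h0)))
  have key : suspHeight (h (suspMk V w s)) = suspHeight (h (suspMk V w 0)) ∨
      suspHeight (h (suspMk V w s)) = suspHeight (h (suspMk V w 1)) := by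
    rcases hx with hx | hx <;> rcases h0 with h0 | h0 <;> rcases h1 with h1 | h1 <;> simp_all
  rcases key with k | k
  · exact Or.inl (congrArg suspHeight (h.injective (suspMk_eq_of_pole k hx)))
  · exact Or.inr (congrArg suspHeight (h.injective (suspMk_eq_of_pole k hx)))

/-- A homeomorphism from a suspension onto `Σ(C₁ * C₂)` maps some suspension arc onto the
suspension arc through a given point of `C₁`. -/
theorem exists_image_suspArc_eq (h : Susp V ≃ₜ Susp (TopJoin C₁ C₂)) (a : C₁) (b : C₂) :
    ∃ v, h '' suspArc V v = suspArc (TopJoin C₁ C₂) (joinMk C₁ C₂ a b 0) := by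
  obtain ⟨m, hm0, hm1⟩ := exists_between (zero_lt_one (α := unitInterval))
  obtain ⟨x, hx⟩ := h.surjective (suspJoinMk (a, b, 0, m))
  obtain ⟨v, r, rfl⟩ := exists_suspMk x
  have hinterior (s : unitInterval) (hs0 : 0 < s) (hs1 : s < 1) :
      0 < suspHeight (h (suspMk V v s)) ∧ suspHeight (h (suspMk V v s)) < 1 :=
    interior_iff_not_pole.2 fun k =>
      interior_iff_not_pole.1 ⟨hs0, hs1⟩ ((suspHeight_homeomorph_pole_iff h).1 k)
  obtain ⟨hr0, hr1⟩ : 0 < r ∧ r < 1 := interior_iff_not_pole.2 fun k => by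
    have := (suspHeight_homeomorph_pole_iff h (x := suspMk V v r)).2 k
    rw [hx] at this
    exact interior_iff_not_pole.1 ⟨hm0, hm1⟩ this
  have hsingular (s : unitInterval) (hs0 : 0 < s) (hs1 : s < 1) :
      ¬ ComponentsLocallyConnectedAt (h (suspMk V v s)) := fun hs => by
    obtain ⟨φ, h0, h1, hφ⟩ := exists_unitInterval_homeomorph hs0 hs1 hr0 hr1
    have := hs.map (h.symm.trans ((suspCongr (Homeomorph.refl V) φ (Or.inl ⟨h0, h1⟩)).trans h))
    rw [Homeomorph.trans_apply, Homeomorph.trans_apply, h.symm_apply_apply, suspCongr_suspMk, hφ,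
      Homeomorph.refl_apply, id_eq, hx] at this
    exact not_componentsLocallyConnectedAt_suspJoinMk_zero hm0 hm1 this
  let T : Set (Susp (TopJoin C₁ C₂)) := h '' (suspMk V v '' Ioo 0 1)
  have hT : IsPreconnected T :=
    (isPreconnected_image_suspMk v isPreconnected_Ioo).image _ h.continuous.continuousOn
  have hTparam {a' : C₁} {b' : C₂} {t' s' : unitInterval} (hmem : suspJoinMk (a', b', t', s') ∈ T) :
      (0 < s' ∧ s' < 1) ∧ (t' = 0 ∨ t' = 1) := by
    obtain ⟨_, ⟨s, ⟨hs0, hs1⟩, rfl⟩, hs⟩ := hmem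
    have hs' : 0 < s' ∧ s' < 1 := by
      have := hinterior s hs0 hs1
      rwa [hs] at this
    refine ⟨hs', ?_⟩
    by_contra ht
    obtain ⟨ht0, ht1⟩ := interior_iff_not_pole.2 ht
    refine hsingular s hs0 hs1 ?_
    rw [hs]
    exact componentsLocallyConnectedAt_suspJoinMk ht0 ht1 hs'.1 hs'.2
  have hxT : suspJoinMk (a, b, 0, m) ∈ T := ⟨_, ⟨r, ⟨hr0, hr1⟩, rfl⟩, hx⟩
  have hzero {a' : C₁} {b' : C₂} {t' s' : unitInterval} (hmem : suspJoinMk (a', b', t', s') ∈ T) :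
      t' = 0 := by
    have hpos := hT.pos_of_suspMk_mem (f := fun y => 1 / 2 - joinParam y)
      (continuous_const.sub continuous_joinParam) (fun y s hy => by
        obtain ⟨a', b', t', rfl⟩ := exists_joinMk y
        obtain ⟨⟨hs0, hs1⟩, rfl | rfl⟩ := hTparam hy
        · exact ⟨hs0, hs1, by norm_num⟩
        · exact ⟨hs0, hs1, by norm_num⟩) hxT hmem (by norm_num)
    refine (hTparam hmem).2.resolve_right ?_
    rintro rfl
    norm_num at hpos
  have hleft : T ⊆ leftPart C₁ C₂ := fun x hx => by
    obtain ⟨a', b', t', s', rfl⟩ := exists_suspJoinMk x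
    refine suspJoinMk_mem_leftPart.2 ⟨?_, (hTparam hx).1⟩
    rw [hzero hx]
    exact zero_lt_one
  have hsub : h '' suspArc V v ⊆ suspArc (TopJoin C₁ C₂) (joinMk C₁ C₂ a b 0) := by
    rintro _ ⟨_, ⟨s, rfl⟩, rfl⟩
    by_cases hs : s = 0 ∨ s = 1
    · exact ⟨_, suspMk_eq_of_pole (suspHeight_suspMk _ _).symm
        (suspHeight_homeomorph_pole h (x := suspMk V v s) hs)⟩
    · have hsT : h (suspMk V v s) ∈ T := ⟨_, ⟨s, interior_iff_not_pole.2 hs, rfl⟩, rfl⟩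
      obtain ⟨a', b', t', s', hs'⟩ := exists_suspJoinMk (h (suspMk V v s))
      rw [← hs'] at hsT ⊢
      obtain rfl := hzero hsT
      obtain rfl := hT.fst_eq hleft hxT hsT
      exact ⟨s', congrArg (suspMk _ · s') (joinMk_zero_eq a b' b)⟩
  refine ⟨v, hsub.antisymm ?_⟩
  rintro _ ⟨s, rfl⟩
  have hpre : IsPreconnected (h '' suspArc V v) := by
    have harc : suspArc V v = suspMk V v '' univ := by
      ext
      simp [suspArc, eq_comm]
    rw [harc]
    exact (isPreconnected_image_suspMk v isPreconnected_univ).image _ h.continuous.continuousOn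
  have hord := (hpre.image _ continuous_suspHeight.continuousOn).ordConnected
  have h0 := suspHeight_homeomorph_pole h (x := suspMk V v 0) (Or.inl rfl)
  have h1 := suspHeight_homeomorph_pole h (x := suspMk V v 1) (Or.inr rfl)
  have hne : suspHeight (h (suspMk V v 0)) ≠ suspHeight (h (suspMk V v 1)) := fun heq =>
    zero_ne_one (congrArg suspHeight (h.injective (suspMk_eq_of_pole heq h0)))
  have hmem (u : unitInterval) : suspHeight (h (suspMk V v u)) ∈
      suspHeight '' (h '' suspArc V v) :=
    mem_image_of_mem _ (mem_image_of_mem _ ⟨u, rfl⟩)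
  have hs : s ∈ suspHeight '' (h '' suspArc V v) := by
    have hs01 : s ∈ Icc (0 : unitInterval) 1 := ⟨unitInterval.nonneg', unitInterval.le_one'⟩
    rcases h0 with h0 | h0 <;> rcases h1 with h1 | h1
    · exact absurd (h0.trans h1.symm) hne
    · exact hord.out (h0 ▸ hmem 0) (h1 ▸ hmem 1) hs01
    · exact hord.out (h1 ▸ hmem 1) (h0 ▸ hmem 0) hs01
    · exact absurd (h0.trans h1.symm) hne
  obtain ⟨x, hxA, rfl⟩ := hs
  obtain ⟨s', rfl⟩ := hsub hxA
  exact hxA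

end Homeomorphisms

theorem Homeomorph.totallySeparatedSpace {X X' : Type*} [TopologicalSpace X] [TopologicalSpace X']
    [TotallySeparatedSpace X'] (e : X ≃ₜ X') : TotallySeparatedSpace X where
  isTotallySeparated_univ x _ y _ hxy := by
    obtain ⟨K, hK, hx, hy⟩ := exists_isClopen_of_totally_separated (e.injective.ne hxy)
    exact ⟨e ⁻¹' K, e ⁻¹' Kᶜ, hK.isOpen.preimage e.continuous,
      hK.compl.isOpen.preimage e.continuous, hx, hy, fun z _ => em (e z ∈ K),
      disjoint_compl_right.preimage e⟩

theorem Homeomorph.perfectSpace {X X' : Type*} [TopologicalSpace X] [TopologicalSpace X']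
    [PerfectSpace X'] (e : X ≃ₜ X') : PerfectSpace X := by
  refine perfectSpace_iff_forall_not_isolated.2 fun x => ?_
  have h := (PerfectSpace.not_isolated (e x)).map e.symm
  have hle : map e.symm (𝓝[≠] e x) ≤ 𝓝[≠] x := by
    have := (e.symm.continuous.tendsto (e x)).mono_left (nhdsWithin_le_nhds (s := {e x}ᶜ))
    rw [e.symm_apply_apply] at this
    refine tendsto_nhdsWithin_of_tendsto_nhds_of_eventually_within _ this ?_
    filter_upwards [self_mem_nhdsWithin] with y hy hyx
    exact hy (e.symm_apply_eq.1 hyx)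
  exact h.mono hle

instance cantorSpace_perfectSpace : PerfectSpace (ℕ → Bool) := by
  refine perfectSpace_iff_forall_not_isolated.2 fun x => ?_
  have h : Tendsto (fun n => Function.update x n (!x n)) atTop (𝓝[≠] x) := by
    refine tendsto_nhdsWithin_of_tendsto_nhds_of_eventually_within _ ?_ (.of_forall fun n hn => ?_)
    · refine tendsto_pi_nhds.2 fun i => tendsto_const_nhds.congr' ?_
      filter_upwards [eventually_gt_atTop i] with n hn
      rw [Function.update_of_ne hn.ne]
    · simpa using congrFun hn n
  exact h.neBot

/-- With `Z ⊆ ΣY` and `h : ΣZ ≃ₜ ΣY` restricting to the inclusion on `Z` as in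
Lemma "isotop": for each `c ∈ C₁ ∪ C₂ ⊆ Y`, the suspension arc of `ΣY` through `c` is the
image under `h` of a suspension arc of `ΣZ`; in particular it meets `Z` in exactly one
point. -/
theorem cantor_arcs_are_Z_arcs (C₁ C₂ : Type u)
    [TopologicalSpace C₁] [TopologicalSpace C₂]
    (e₁ : C₁ ≃ₜ (ℕ → Bool)) (e₂ : C₂ ≃ₜ (ℕ → Bool))
    (Z : Set (Susp (TopJoin C₁ C₂)))
    (h : Susp ↥Z ≃ₜ Susp (TopJoin C₁ C₂))
    (hrestr : ∀ z : Z, h (suspMk ↥Z z ⟨1/2, by norm_num [Set.mem_Icc]⟩) = ↑z) :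
    ∀ c ∈ joinC1 C₁ C₂ ∪ joinC2 C₁ C₂, ∃ z : Z,
      h '' suspArc ↥Z z = suspArc (TopJoin C₁ C₂) c ∧
      suspArc (TopJoin C₁ C₂) c ∩ Z = {(z : Susp (TopJoin C₁ C₂))} := by
  have := e₁.totallySeparatedSpace
  have := e₂.totallySeparatedSpace
  have := e₁.perfectSpace
  have := e₂.perfectSpace
  intro c hc
  obtain ⟨z, hz⟩ : ∃ z, h '' suspArc Z z = suspArc (TopJoin C₁ C₂) c := by
    rcases hc with ⟨a, b, rfl⟩ | ⟨a, b, rfl⟩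
    · exact exists_image_suspArc_eq h a b
    · let k := suspCongr (joinComm C₁ C₂) (Homeomorph.refl unitInterval) (Or.inl ⟨rfl, rfl⟩)
      obtain ⟨z, hz⟩ := exists_image_suspArc_eq (h.trans k) b a
      refine ⟨z, k.injective.image_injective ?_⟩
      rw [← image_comp]
      refine hz.trans ?_
      have hjoin : joinMk C₂ C₁ b a 0 = joinComm C₁ C₂ (joinMk C₁ C₂ a b 1) := by
        rw [← unitInterval.symm_one]
        rfl
      rw [hjoin]
      ext x
      constructor
      · rintro ⟨s, rfl⟩
        exact ⟨_, ⟨s, rfl⟩, rfl⟩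
      · rintro ⟨_, ⟨s, rfl⟩, rfl⟩
        exact ⟨s, rfl⟩
  refine ⟨z, hz, ?_⟩
  rw [← hz]
  ext x
  constructor
  · rintro ⟨⟨_, ⟨r, rfl⟩, rfl⟩, hxZ⟩
    have hr := h.injective (hrestr ⟨_, hxZ⟩)
    have hr' : _ = r := congrArg suspHeight hr
    rw [← hr']
    exact hrestr z
  · rintro rfl
    exact ⟨⟨_, ⟨_, rfl⟩, hrestr z⟩, z.2⟩
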